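/- Let a, b, c be positive real numbers with b² − 4ac = 1, set Q(X,Y) = aX² + bXY + cY², and let w := (b+1)/(2c), w' := (b−1)/(2c), so that 0 < w' < w are the roots of Q(1,−x) = 0. Let k ≥ 2 be an integer, α ∈ ℝ and β ∈ ℝ∖ℤ. Then the double series Σ_{p≥1, q≥0} e^{2πi(pα+qβ)} / Q(p,q)^k converges absolutely, the function x ↦ 𝓕_{2k}(x; α, β) is infinitely differentiable on (0,∞), and Σ_{p≥1, q≥0} e^{2πi(pα+qβ)} / Q(p,q)^k = − Σ_{i=0}^{k−1} binom(2k−2−i, k−1) · [𝓕_{2k}^{(i)}(w; α, β) − (−1)^i 𝓕_{2k}^{(i)}(w'; α, β)] / (i! · (w' − w)^{k−1−i}), where 𝓕_{2k}^{(i)} denotes the i-th derivative in the first variable. -/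

import Mathlib

open Complex MeasureTheory Filter Topology Set Asymptotics

noncomputable section

/-- `e2pi θ = e^{2πiθ}`. -/
def e2pi (θ : ℝ) : ℂ := Complex.exp (2 * Real.pi * Complex.I * θ)

/-- Polylogarithm of integer order: `Li 0 z = z/(1-z)`, `Li 1 z = -Log(1-z)`,
`Li m z = ∑_{n≥1} z^n/n^m` for `m ≥ 2`. -/
def Li : ℕ → ℂ → ℂ
  | 0, z => z / (1 - z)
  | 1, z => -Complex.log (1 - z)
  | (m+2), z => ∑' n : ℕ, z ^ (n+1) / ((n+1 : ℕ) : ℂ) ^ (m+2)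

/-- The higher Herglotz–Zagier–Novikov function
`𝓕_k(x; α, β) = ∫₀^∞ Li_{k-1}(e^{-xt} e^{2πiα}) / (1 - e^{-t} e^{2πiβ}) dt`. -/
def HHZN (k : ℕ) (x : ℂ) (α β : ℝ) : ℂ :=
  ∫ t in Set.Ioi (0:ℝ),
    Li (k-1) (Complex.exp (-x * t) * e2pi α) / (1 - Complex.exp (-(t:ℂ)) * e2pi β)

/-- The indefinite binary quadratic form `Q(X,Y) = aX² + bXY + cY²`. -/
def Qform (a b c : ℝ) (X Y : ℝ) : ℝ := a * X ^ 2 + b * X * Y + c * Y ^ 2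

def Kf (β : ℝ) (t : ℝ) : ℂ := (1 - Complex.exp (-(t:ℂ)) * e2pi β)⁻¹

lemma norm_e2pi (θ : ℝ) : ‖e2pi θ‖ = 1 := by
  unfold e2pi
  rw [show (2 * Real.pi * Complex.I * θ : ℂ) = ((2 * Real.pi * θ : ℝ) : ℂ) * Complex.I by push_cast; ring]
  exact Complex.norm_exp_ofReal_mul_I _

lemma e2pi_add (x y : ℝ) : e2pi (x + y) = e2pi x * e2pi y := by
  unfold e2pi
  rw [← Complex.exp_add]; congr 1; push_cast; ring

lemma e2pi_nat_mul (n : ℕ) (x : ℝ) : e2pi (n * x) = e2pi x ^ n := by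
  unfold e2pi
  rw [← Complex.exp_nat_mul]; congr 1; push_cast; ring

lemma e2pi_ne_one (β : ℝ) (hβ : ∀ n : ℤ, β ≠ n) : e2pi β ≠ 1 := by
  intro h
  unfold e2pi at h
  rw [Complex.exp_eq_one_iff] at h
  obtain ⟨n, hn⟩ := h
  apply hβ n
  have h2 : (2 * Real.pi * Complex.I : ℂ) ≠ 0 := Complex.two_pi_I_ne_zero
  have : (2 * Real.pi * Complex.I : ℂ) * β = (2 * Real.pi * Complex.I : ℂ) * n := by
    rw [hn]; ring
  have := mul_left_cancel₀ h2 this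
  exact_mod_cast this

lemma one_sub_ne (β : ℝ) (hβ : ∀ n : ℤ, β ≠ n) (r : ℝ) (hr : 0 ≤ r) : (1 - (r:ℂ) * e2pi β) ≠ 0 := by
  intro h
  have h1 : (r:ℂ) * e2pi β = 1 := (sub_eq_zero.mp h).symm
  have h2 := congrArg norm h1
  rw [norm_mul, norm_e2pi, mul_one, norm_one, Complex.norm_real, Real.norm_of_nonneg hr] at h2
  rw [h2] at h1
  apply e2pi_ne_one β hβ
  simpa using h1

lemma Kf_bound (β : ℝ) (hβ : ∀ n : ℤ, β ≠ n) : ∃ M : ℝ, 0 < M ∧ ∀ t : ℝ, 0 ≤ t → ‖Kf β t‖ ≤ M := by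
  have hc : ContinuousOn (fun r : ℝ => ‖(1 - (r:ℂ) * e2pi β)⁻¹‖) (Set.Icc 0 1) := by
    apply ContinuousOn.norm
    apply ContinuousOn.inv₀ (by fun_prop)
    intro r hr; exact one_sub_ne β hβ r hr.1
  obtain ⟨M, hM⟩ := isCompact_Icc.bddAbove_image hc
  refine ⟨max M 1, by positivity, fun t ht => le_trans ?_ (le_max_left _ _)⟩
  apply hM
  refine ⟨Real.exp (-t), ⟨(Real.exp_pos _).le, Real.exp_le_one_iff.mpr (by linarith)⟩, ?_⟩
  simp [Kf]

lemma Kf_cont (β : ℝ) (hβ : ∀ n : ℤ, β ≠ n) : Continuous (Kf β) := by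
  unfold Kf
  apply Continuous.inv₀ (by fun_prop)
  intro t
  have := one_sub_ne β hβ (Real.exp (-t)) (Real.exp_pos _).le
  simpa using this

lemma int_val (i : ℕ) (y : ℝ) (hy : 0 < y) :
    ∫ t in Set.Ioi (0:ℝ), t ^ i * Real.exp (-(y * t)) = (Nat.factorial i : ℝ) / y ^ (i+1) := by
  have := Real.integral_rpow_mul_exp_neg_mul_Ioi (a := (i:ℝ)+1) (by positivity) hy
  rw [Real.Gamma_nat_eq_factorial, add_sub_cancel_right] at this
  simp only [Real.rpow_natCast] at this
  rw [this]
  have e : ((i:ℝ)+1) = ((i+1 : ℕ) : ℝ) := by push_cast; ring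
  rw [e, Real.rpow_natCast]; rw [one_div, inv_pow]; ring

lemma int_int (i : ℕ) (y : ℝ) (hy : 0 < y) :
    IntegrableOn (fun t : ℝ => t ^ i * Real.exp (-(y * t))) (Set.Ioi 0) := by
  apply MeasureTheory.Integrable.of_integral_ne_zero
  rw [int_val i y hy]; positivity

def hf (β : ℝ) (i : ℕ) (y t : ℝ) : ℂ := (((-t) ^ i * Real.exp (-(y * t)) : ℝ) : ℂ) * Kf β t

def Hf (β : ℝ) (i : ℕ) (y : ℝ) : ℂ := ∫ t in Set.Ioi (0:ℝ), hf β i y t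

lemma hf_cont (β : ℝ) (hβ : ∀ n : ℤ, β ≠ n) (i : ℕ) (y : ℝ) : Continuous (hf β i y) := by
  have := Kf_cont β hβ
  unfold hf
  fun_prop

lemma hf_norm (β : ℝ) (i : ℕ) (y t : ℝ) (M : ℝ) (hM : ∀ t : ℝ, 0 ≤ t → ‖Kf β t‖ ≤ M) (ht : 0 < t) :
    ‖hf β i y t‖ ≤ (t ^ i * Real.exp (-(y * t))) * M := by
  unfold hf
  rw [norm_mul, Complex.norm_real, norm_mul, norm_pow, norm_neg, Real.norm_of_nonneg ht.le,
    Real.norm_of_nonneg (Real.exp_pos _).le]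
  exact mul_le_mul_of_nonneg_left (hM t ht.le) (by positivity)

lemma hf_int (β : ℝ) (hβ : ∀ n : ℤ, β ≠ n) (i : ℕ) (y : ℝ) (hy : 0 < y) :
    IntegrableOn (hf β i y) (Set.Ioi 0) := by
  obtain ⟨M, hM0, hM⟩ := Kf_bound β hβ
  refine MeasureTheory.Integrable.mono' ((int_int i y hy).mul_const M)
    (hf_cont β hβ i y).aestronglyMeasurable ?_
  refine (ae_restrict_iff' measurableSet_Ioi).mpr (ae_of_all _ fun t ht => ?_)
  exact hf_norm β i y t M hM ht

lemma hf_intnorm (β : ℝ) (hβ : ∀ n : ℤ, β ≠ n) (i : ℕ) (y : ℝ) (hy : 0 < y) (M : ℝ)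
    (hM : ∀ t : ℝ, 0 ≤ t → ‖Kf β t‖ ≤ M) :
    ∫ t in Set.Ioi (0:ℝ), ‖hf β i y t‖ ≤ (Nat.factorial i : ℝ) / y ^ (i+1) * M := by
  rw [← int_val i y hy, ← integral_mul_const]
  apply setIntegral_mono_on (hf_int β hβ i y hy).norm ((int_int i y hy).mul_const M) measurableSet_Ioi
  intro t ht
  exact hf_norm β i y t M hM ht

lemma Hf_norm (β : ℝ) (hβ : ∀ n : ℤ, β ≠ n) (i : ℕ) (y : ℝ) (hy : 0 < y) (M : ℝ)
    (hM : ∀ t : ℝ, 0 ≤ t → ‖Kf β t‖ ≤ M) :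
    ‖Hf β i y‖ ≤ (Nat.factorial i : ℝ) / y ^ (i+1) * M :=
  (norm_integral_le_integral_norm _).trans (hf_intnorm β hβ i y hy M hM)

lemma Hf_deriv (β : ℝ) (hβ : ∀ n : ℤ, β ≠ n) (i : ℕ) (y : ℝ) (hy : 0 < y) :
    HasDerivAt (Hf β i) (Hf β (i+1) y) y := by
  obtain ⟨M, hM0, hM⟩ := Kf_bound β hβ
  unfold Hf
  refine (hasDerivAt_integral_of_dominated_loc_of_deriv_le (F := fun y t => hf β i y t)
    (F' := fun y t => hf β (i+1) y t) (s := Set.Ioi (y/2))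
    (bound := fun t => t ^ (i+1) * Real.exp (-(y/2 * t)) * M)
    (Ioi_mem_nhds (by linarith)) ?_ ?_ ?_ ?_ ?_ ?_).2
  · exact Eventually.of_forall fun x => (hf_cont β hβ i x).aestronglyMeasurable
  · exact hf_int β hβ i y hy
  · exact (hf_cont β hβ (i+1) y).aestronglyMeasurable
  · refine (ae_restrict_iff' measurableSet_Ioi).mpr (ae_of_all _ fun t ht x hx => ?_)
    have ht' : 0 < t := ht
    refine (hf_norm β (i+1) x t M hM ht).trans ?_
    have hx' : y / 2 < x := hx
    gcongr
  · exact (int_int (i+1) (y/2) (by linarith)).mul_const M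
  · refine ae_of_all _ fun t x hx => ?_
    unfold hf
    apply HasDerivAt.mul_const
    apply HasDerivAt.ofReal_comp
    have h1 : HasDerivAt (fun x : ℝ => -(x * t)) (-(1 * t)) x := ((hasDerivAt_id x).mul_const t).neg
    have h2 := (h1.exp).const_mul ((-t)^i)
    refine h2.congr_deriv ?_
    ring

/-- partial sums -/
lemma Hf_partial (β : ℝ) (hβ : ∀ n : ℤ, β ≠ n) (i : ℕ) (y : ℝ) (hy : 0 < y) :
    Tendsto (fun N : ℕ => ∑ q ∈ Finset.range N, e2pi β ^ q *
      ((-1) ^ i * (Nat.factorial i : ℂ) / ((y + q : ℝ) : ℂ) ^ (i+1))) atTop (𝓝 (Hf β i y)) := by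
  obtain ⟨M, hM0, hM⟩ := Kf_bound β hβ
  have hterm : ∀ q : ℕ, ((-1) ^ i * (Nat.factorial i : ℂ) / ((y + q : ℝ) : ℂ) ^ (i+1)) =
      ∫ t in Set.Ioi (0:ℝ), (((-t) ^ i * Real.exp (-((y + q) * t)) : ℝ) : ℂ) := by
    intro q
    rw [integral_complex_ofReal]
    have : ∀ t : ℝ, (-t) ^ i * Real.exp (-((y + q) * t)) = (-1)^i * (t ^ i * Real.exp (-((y + q) * t))) := by
      intro t; rw [neg_pow]; ring
    simp only [this]
    rw [integral_const_mul, int_val i (y+q) (by positivity)]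
    push_cast; ring
  have hint : ∀ q : ℕ, IntegrableOn (fun t : ℝ => (((-t) ^ i * Real.exp (-((y + q) * t)) : ℝ) : ℂ)) (Set.Ioi 0) := by
    intro q
    have : ∀ t : ℝ, (-t) ^ i * Real.exp (-((y + q) * t)) = (-1)^i * (t ^ i * Real.exp (-((y + q) * t))) := by
      intro t; rw [neg_pow]; ring
    simp only [this]
    exact ((int_int i (y+q) (by positivity)).const_mul ((-1)^i)).ofReal
  have hdiff : ∀ N : ℕ, (∑ q ∈ Finset.range N, e2pi β ^ q *
      ((-1) ^ i * (Nat.factorial i : ℂ) / ((y + q : ℝ) : ℂ) ^ (i+1))) =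
      Hf β i y - e2pi β ^ N * Hf β i (y + N) := by
    intro N
    simp only [hterm, ← integral_const_mul]
    rw [← integral_finsetSum _ (fun q _ => (hint q).const_mul _)]
    unfold Hf
    rw [← integral_const_mul, ← integral_sub (hf_int β hβ i y hy) ((hf_int β hβ i (y+N) (by positivity)).const_mul _)]
    congr 1
    ext t
    have hne : (1 - Complex.exp (-(t:ℂ)) * e2pi β) ≠ 0 := by
      have := one_sub_ne β hβ (Real.exp (-t)) (Real.exp_pos _).le
      simpa using this
    have hexp : ∀ q : ℕ, (((-t) ^ i * Real.exp (-((y + q) * t)) : ℝ) : ℂ) =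
        (((-t) ^ i * Real.exp (-(y * t)) : ℝ) : ℂ) * Complex.exp (-(t:ℂ)) ^ q := by
      intro q
      rw [← Complex.exp_nat_mul]
      rw [show -((y + q) * t) = -(y*t) + q * (-t) by ring, Real.exp_add]
      push_cast; ring
    unfold hf Kf
    simp only [hexp]
    have hg := geom_sum_eq (x := Complex.exp (-(t:ℂ)) * e2pi β) (by
      intro h; apply hne; rw [h]; ring) N
    have : ∑ q ∈ Finset.range N, e2pi β ^ q * ((((-t) ^ i * Real.exp (-(y * t)) : ℝ) : ℂ) * Complex.exp (-(t:ℂ)) ^ q)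
      = (((-t) ^ i * Real.exp (-(y * t)) : ℝ) : ℂ) * ∑ q ∈ Finset.range N, (Complex.exp (-(t:ℂ)) * e2pi β) ^ q := by
      rw [Finset.mul_sum]
      refine Finset.sum_congr rfl fun q _ => ?_
      rw [mul_pow]; ring
    rw [this, hg, ← neg_div_neg_eq, div_eq_mul_inv, neg_sub, neg_sub, mul_pow]
    ring
  simp only [hdiff]
  have h0 : Tendsto (fun N : ℕ => e2pi β ^ N * Hf β i (y + N)) atTop (𝓝 0) := by
    apply squeeze_zero_norm (a := fun N : ℕ => (Nat.factorial i : ℝ) / (y + N) ^ (i+1) * M)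
    · intro N
      rw [norm_mul, norm_pow, norm_e2pi, one_pow, one_mul]
      exact Hf_norm β hβ i (y+N) (by positivity) M hM
    · have h1 : Tendsto (fun N : ℕ => y + (N:ℝ)) atTop atTop :=
        tendsto_atTop_add_const_left _ _ tendsto_natCast_atTop_atTop
      have h2 := (tendsto_pow_atTop (α := ℝ) (Nat.succ_ne_zero i)).comp h1
      have h3 := (h2.const_div_atTop (Nat.factorial i : ℝ)).mul_const M
      simpa using h3
  simpa using (tendsto_const_nhds (x := Hf β i y)).sub h0

lemma smooth_aux (f : ℕ → ℝ → ℂ) (h : ∀ i x, 0 < x → HasDerivAt (f i) (f (i+1) x) x) :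
    ∀ (n : ℕ) (i : ℕ), ContDiffOn ℝ n (f i) (Set.Ioi 0) := by
  intro n
  induction n with
  | zero =>
    intro i
    exact contDiffOn_zero.mpr fun x hx => (h i x hx).continuousAt.continuousWithinAt
  | succ n ih =>
    intro i
    push_cast
    rw [contDiffOn_succ_iff_deriv_of_isOpen isOpen_Ioi]
    refine ⟨fun x hx => (h i x hx).differentiableAt.differentiableWithinAt, by simp, ?_⟩
    exact (ih (i+1)).congr fun x hx => (h i x hx).deriv

lemma iter_aux (g : ℝ → ℂ) (f : ℕ → ℝ → ℂ) (hg : ∀ x, 0 < x → g x = f 0 x)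
    (h : ∀ i x, 0 < x → HasDerivAt (f i) (f (i+1) x) x) :
    ∀ (i : ℕ) (x : ℝ), 0 < x → iteratedDeriv i g x = f i x := by
  intro i
  induction i with
  | zero => intro x hx; simpa using hg x hx
  | succ i ih =>
    intro x hx
    rw [iteratedDeriv_succ]
    have : iteratedDeriv i g =ᶠ[𝓝 x] f i := by
      filter_upwards [Ioi_mem_nhds hx] with z hz using ih z hz
    rw [this.deriv_eq, (h i x hx).deriv]

/-- `i`-th derivative, term -/
def Ft (m : ℕ) (α β : ℝ) (i : ℕ) (p : ℕ) (x : ℝ) : ℂ :=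
  e2pi α ^ (p+1) * ((p+1 : ℕ) : ℂ) ^ i / ((p+1 : ℕ) : ℂ) ^ m * Hf β i ((p+1 : ℕ) * x)

lemma Ft_norm (m : ℕ) (hm : 1 ≤ m) (α β : ℝ) (hβ : ∀ n : ℤ, β ≠ n) (i p : ℕ) (ε x : ℝ) (he : 0 < ε) (hx : ε ≤ x) (M : ℝ)
    (hM0 : 0 < M) (hM : ∀ t : ℝ, 0 ≤ t → ‖Kf β t‖ ≤ M) :
    ‖Ft m α β i p x‖ ≤ (Nat.factorial i : ℝ) / ε ^ (i+1) * M * (1 / ((p+1 : ℕ) : ℝ) ^ 2) := by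
  unfold Ft
  have hp : (1:ℝ) ≤ ((p+1 : ℕ) : ℝ) := by push_cast; linarith [Nat.cast_nonneg (α := ℝ) p]
  have hx0 : 0 < x := lt_of_lt_of_le he hx
  rw [norm_mul, norm_div, norm_mul, norm_pow, norm_e2pi, norm_pow, norm_pow, Complex.norm_natCast, one_pow, one_mul]
  have h1 := Hf_norm β hβ i ((p+1:ℕ)*x) (by positivity) M hM
  generalize ((p+1 : ℕ) : ℝ) = P at *
  have hP : 0 < P := by linarith
  calc P ^ i / P ^ m * ‖Hf β i (P * x)‖ ≤ P ^ i / P ^ m * ((Nat.factorial i : ℝ) / (P * x) ^ (i+1) * M) := by gcongr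
    _ = (Nat.factorial i : ℝ) / x ^ (i+1) * M * (1 / P ^ (m+1)) := by
      rw [mul_pow]; field_simp; ring
    _ ≤ _ := by
      gcongr
      omega

lemma summ_sq (C : ℝ) : Summable (fun p : ℕ => C * (1 / ((p+1 : ℕ) : ℝ) ^ 2)) := by
  apply Summable.mul_left
  exact (summable_nat_add_iff 1).mpr (Real.summable_one_div_nat_pow.mpr (by norm_num : 1 < 2))

lemma Ft_summable (m : ℕ) (hm : 1 ≤ m) (α β : ℝ) (hβ : ∀ n : ℤ, β ≠ n) (i : ℕ) (x : ℝ) (hx : 0 < x) :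
    Summable (fun p => Ft m α β i p x) := by
  obtain ⟨M, hM0, hM⟩ := Kf_bound β hβ
  exact Summable.of_norm_bounded (summ_sq _) fun p => Ft_norm m hm α β hβ i p x x hx le_rfl M hM0 hM

lemma Ft_deriv (m : ℕ) (hm : 1 ≤ m) (α β : ℝ) (hβ : ∀ n : ℤ, β ≠ n) (i : ℕ) (x : ℝ) (hx : 0 < x) :
    HasDerivAt (fun x => ∑' p, Ft m α β i p x) (∑' p, Ft m α β (i+1) p x) x := by
  obtain ⟨M, hM0, hM⟩ := Kf_bound β hβ
  refine hasDerivAt_tsum_of_isPreconnected (g := fun p x => Ft m α β i p x)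
    (g' := fun p x => Ft m α β (i+1) p x) (t := Set.Ioi (x/2)) (y₀ := x)
    (summ_sq _) isOpen_Ioi isPreconnected_Ioi ?_
    (fun p y hy => Ft_norm m hm α β hβ (i+1) p (x/2) y (by linarith) (le_of_lt hy) M hM0 hM) (by simp; linarith)
    (Ft_summable m hm α β hβ i x hx) (by simp; linarith)
  intro p y hy
  have hy0 : 0 < y := lt_trans (by linarith) (show x/2 < y from hy)
  unfold Ft
  have h1 := Hf_deriv β hβ i ((p+1:ℕ)*y) (by positivity)
  have h2 : HasDerivAt (fun y : ℝ => ((p+1:ℕ):ℝ) * y) ((p+1:ℕ):ℝ) y := by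
    simpa using (hasDerivAt_id y).const_mul ((p+1:ℕ):ℝ)
  have h3 := (h1.scomp y h2).const_mul (e2pi α ^ (p+1) * ((p+1 : ℕ) : ℂ) ^ i / ((p+1 : ℕ) : ℂ) ^ m)
  refine h3.congr_deriv ?_
  rw [Complex.real_smul]
  push_cast
  ring

lemma HHZN_eq (k : ℕ) (hk : 2 ≤ k) (α β : ℝ) (hβ : ∀ n : ℤ, β ≠ n) (x : ℝ) (hx : 0 < x) :
    HHZN (2*k) (x:ℂ) α β = ∑' p, Ft (2*k-1) α β 0 p x := by
  obtain ⟨M, hM0, hM⟩ := Kf_bound β hβ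
  obtain ⟨m, hm⟩ : ∃ m, 2 * k - 1 = m + 2 := ⟨2*k-3, by omega⟩
  unfold HHZN Ft Hf
  rw [hm]
  simp only [← integral_const_mul]
  rw [integral_tsum_of_summable_integral_norm]
  · refine setIntegral_congr_fun measurableSet_Ioi fun t ht => ?_
    simp only [Li, hf]
    rw [div_eq_mul_inv, ← tsum_mul_right]
    congr 1
    ext p
    rw [mul_pow, ← Complex.exp_nat_mul]
    simp only [pow_zero, one_mul, mul_one, Complex.ofReal_exp, Kf]
    rw [show ((p+1:ℕ):ℂ) * (-(x:ℂ) * t) = ((-(((p+1:ℕ):ℝ) * x * t) : ℝ) : ℂ) by push_cast; ring]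
    ring
  · intro p
    exact (hf_int β hβ 0 _ (by positivity)).const_mul _
  · refine Summable.of_nonneg_of_le (fun p => integral_nonneg fun t => norm_nonneg _) (fun p => ?_) (summ_sq (1 / x * M))
    simp only [norm_mul]
    rw [integral_const_mul]
    have h1 := hf_intnorm β hβ 0 ((p+1:ℕ)*x) (by positivity) M hM
    have hp : (1:ℝ) ≤ ((p+1 : ℕ) : ℝ) := by push_cast; linarith [Nat.cast_nonneg (α := ℝ) p]
    rw [norm_div, norm_mul, norm_pow, norm_e2pi, norm_pow, norm_pow, Complex.norm_natCast, one_pow, one_mul]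
    generalize ((p+1 : ℕ) : ℝ) = P at *
    have hP : 0 < P := by linarith
    calc P ^ 0 / P ^ (m+2) * _ ≤ P ^ 0 / P ^ (m+2) * ((Nat.factorial 0 : ℝ) / (P * x) ^ (0+1) * M) := by gcongr
      _ = 1 / x * M * (1 / P ^ (m+3)) := by
        simp; field_simp; ring
      _ ≤ _ := by
        gcongr
        omega

lemma pf_step (x : ℂ) (k : ℕ) (n : ℕ) :
    (1 - x) * ∑ j ∈ Finset.range n, ((k + 1 + j).choose j : ℂ) * x ^ j
      = ∑ j ∈ Finset.range n, ((k + j).choose j : ℂ) * x ^ j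
        - (if n = 0 then 0 else ((k + n).choose (n-1) : ℂ)) * x ^ n := by
  induction n with
  | zero => simp
  | succ n ih =>
    rw [Finset.sum_range_succ, mul_add, ih, Finset.sum_range_succ]
    rcases n with _ | n
    · simp
      try ring
    · have h : (k + 1 + (n+1)).choose (n+1) = (k + (n+1)).choose n + (k+(n+1)).choose (n+1) := by
        rw [show k + 1 + (n+1) = (k + (n+1)) + 1 by ring, Nat.choose_succ_succ]
      have h2 : (k + (n + 1 + 1)).choose (n + 1) = (k + 1 + (n+1)).choose (n+1) := by
        congr 1; ring
      simp only [Nat.add_sub_cancel, h2, h, if_neg (Nat.succ_ne_zero _), if_neg (show n + 1 + 1 ≠ 0 by omega)]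
      push_cast
      ring

lemma pf_core (k : ℕ) (x y : ℂ) (h : x + y = 1) :
    y ^ (k+1) * ∑ j ∈ Finset.range (k+1), ((k + j).choose j : ℂ) * x ^ j
    + x ^ (k+1) * ∑ j ∈ Finset.range (k+1), ((k + j).choose j : ℂ) * y ^ j = 1 := by
  induction k with
  | zero => simp; rw [add_comm]; exact h
  | succ k ih =>
    have hy : y = 1 - x := by rw [← h]; ring
    have hx : x = 1 - y := by rw [← h]; ring
    have e1 := pf_step x k (k+1+1)
    have e2 := pf_step y k (k+1+1)
    rw [← hy, Finset.sum_range_succ (fun j => ((k + j).choose j : ℂ) * x ^ j)] at e1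
    rw [← hx, Finset.sum_range_succ (fun j => ((k + j).choose j : ℂ) * y ^ j)] at e2
    have hc : (k + (k+1+1)).choose (k+1) = 2 * (k+(k+1)).choose (k+1) := by
      rw [show k + (k+1+1) = (k+(k+1)) + 1 by ring, Nat.choose_succ_succ']
      have : (k+(k+1)).choose k = (k+(k+1)).choose (k+1) := by
        apply Nat.choose_symm_of_eq_add; ring
      omega
    simp only [if_neg (show k + 1 + 1 ≠ 0 by omega), show k+1+1-1 = k+1 by omega, hc] at e1 e2
    rw [pow_succ y, pow_succ x, mul_assoc, mul_assoc, e1, e2, ← ih]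
    push_cast
    linear_combination (-2 * ((k+(k+1)).choose (k+1) : ℂ) * (x*y)^(k+1)) * h

lemma pf_main (k : ℕ) (s r : ℂ) (hs : s ≠ 0) (hr : r ≠ 0) (h : s + r = s * r) :
    (s * r) ^ (k+1) = ∑ i ∈ Finset.range (k+1), ((2 * k - i).choose k : ℂ) * (s ^ (i+1) + r ^ (i+1)) := by
  have h1 : s⁻¹ + r⁻¹ = 1 := by field_simp; rw [← h]; ring
  have := pf_core k s⁻¹ r⁻¹ h1
  rw [← Finset.sum_range_reflect]
  calc (s*r)^(k+1) = (s*r)^(k+1) * 1 := by ring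
    _ = _ := by
      rw [← this, mul_add, Finset.mul_sum, Finset.mul_sum, Finset.mul_sum, Finset.mul_sum, ← Finset.sum_add_distrib]
      refine Finset.sum_congr rfl fun j hj => ?_
      have hj' : j ≤ k := by simpa [Nat.lt_succ_iff] using hj
      obtain ⟨m, rfl⟩ := Nat.exists_eq_add_of_le hj'
      have e : (2 * (j+m) - (j + m + 1 - 1 - j)).choose (j+m) = (j + m + j).choose j := by
        rw [show 2 * (j+m) - (j + m + 1 - 1 - j) = j + m + j by omega]
        exact Nat.choose_symm_of_eq_add (by ring)
      rw [e, show j + m + 1 - 1 - j + 1 = m + 1 by omega]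
      rw [show j + m + 1 = (m+1) + j by ring]
      generalize ((j + m + j).choose j : ℂ) = C
      simp only [inv_pow, mul_pow, pow_add _ (m+1) j]
      have a1 : s ^ j ≠ 0 := pow_ne_zero _ hs
      have a2 : r ^ j ≠ 0 := pow_ne_zero _ hr
      have a3 : s ^ (m+1) ≠ 0 := pow_ne_zero _ hs
      have a4 : r ^ (m+1) ≠ 0 := pow_ne_zero _ hr
      generalize s ^ j = A at *
      generalize r ^ j = B at *
      generalize s ^ (m+1) = C' at *
      generalize r ^ (m+1) = D at *
      field_simp

lemma pf_pt (K : ℕ) (P u v δ : ℂ) (hP : P ≠ 0) (hu : u ≠ 0) (hv : v ≠ 0) (hδ : δ ≠ 0) (h : v - u = P * δ) :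
    1 / (-(u * v) / δ) ^ (K+1) = -∑ i ∈ Finset.range (K+1), ((2 * (K+1) - 2 - i).choose (K+1-1) : ℂ) *
      (P ^ i / P ^ (2*(K+1)-1) * ((-1)^i * (Nat.factorial i : ℂ) / u ^ (i+1))
        - (-1)^i * (P ^ i / P ^ (2*(K+1)-1) * ((-1)^i * (Nat.factorial i : ℂ) / v ^ (i+1))))
      / ((Nat.factorial i : ℂ) * δ ^ (K+1-1-i)) := by
  have hm := pf_main K (-(P*δ)/u) (P*δ/v) (div_ne_zero (neg_ne_zero.mpr (mul_ne_zero hP hδ)) hu)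
    (div_ne_zero (mul_ne_zero hP hδ) hv) (by
      field_simp
      linear_combination (-1 : ℂ) * h)
  have hl : 1 / (-(u * v) / δ) ^ (K+1) = (-(P*δ)/u * (P*δ/v)) ^ (K+1) / (P^2*δ)^(K+1) := by
    rw [← div_pow, one_div, ← inv_pow]; congr 1; field_simp
  rw [hl, hm, Finset.sum_div, ← Finset.sum_neg_distrib]
  refine Finset.sum_congr rfl fun i hi => ?_
  have hi' : i ≤ K := by simpa [Nat.lt_succ_iff] using hi
  obtain ⟨n, rfl⟩ := Nat.exists_eq_add_of_le hi'
  have hf : (Nat.factorial i : ℂ) ≠ 0 := by exact_mod_cast Nat.factorial_ne_zero i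
  rw [show 2 * (i+n+1) - 2 - i = 2 * (i+n) - i by omega, show i + n + 1 - 1 = i + n by omega,
    show i + n - i = n by omega, show 2 * (i+n+1) - 1 = i + (i+1+2*n) by omega]
  generalize ((2 * (i+n) - i).choose (i+n) : ℂ) = C
  have hs : ((-1:ℂ)^i) * (-1)^i = 1 := by rw [← mul_pow]; simp
  rw [div_pow, div_pow, neg_pow (P*δ) (i+1), pow_succ (-1:ℂ) i]
  generalize (-1:ℂ)^i = S at *
  have e1 : (P^2*δ)^(i+n+1) = (P^(i+1+2*n) * (P*δ)^(i+1)) * δ^n := by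
    rw [mul_pow, mul_pow, ← pow_mul]; ring
  rw [e1, pow_add P i]
  have hPd : (P*δ)^(i+1) ≠ 0 := pow_ne_zero _ (mul_ne_zero hP hδ)
  generalize (P*δ)^(i+1) = X at *
  generalize hY : P^(i+1+2*n) = Y at *
  have hY0 : Y ≠ 0 := hY ▸ pow_ne_zero _ hP
  have hPi : P^i ≠ 0 := pow_ne_zero _ hP
  have hui : u^(i+1) ≠ 0 := pow_ne_zero _ hu
  have hvi : v^(i+1) ≠ 0 := pow_ne_zero _ hv
  have hdn : δ^n ≠ 0 := pow_ne_zero _ hδ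
  generalize P^i = A at *
  generalize u^(i+1) = U at *
  generalize v^(i+1) = V at *
  generalize δ^n = D at *
  field_simp
  linear_combination (-(C*U)) * hs

lemma summ_main (a b c : ℝ) (ha : 0 < a) (hb : 0 < b) (hc : 0 < c) (k : ℕ) (hk : 2 ≤ k) (α β : ℝ) :
    Summable (fun pq : ℕ × ℕ =>
      ‖e2pi ((pq.1 + 1) * α + pq.2 * β) / (Qform a b c (pq.1 + 1) pq.2 : ℂ) ^ k‖) := by
  have hμ : 0 < min a b := lt_min ha hb
  set μ := min a b with hμd
  have hs := summ_sq 1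
  simp only [one_mul] at hs
  have hp := (hs.mul_of_nonneg hs (fun p => by positivity) (fun p => by positivity)).mul_left (1 / μ^k)
  refine Summable.of_nonneg_of_le (fun _ => norm_nonneg _) (fun pq => ?_) hp
  obtain ⟨p, q⟩ := pq
  simp only
  rw [norm_div, norm_e2pi, norm_pow, Complex.norm_real]
  have hP : (1:ℝ) ≤ (p:ℝ)+1 := by linarith [Nat.cast_nonneg (α := ℝ) p]
  have hq : (0:ℝ) ≤ (q:ℝ) := Nat.cast_nonneg q
  push_cast
  generalize (p:ℝ)+1 = P at *
  generalize (q:ℝ) = q at *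
  have h1 : μ * (P * (q+1)) ≤ Qform a b c P q := by
    unfold Qform
    have ha' : μ ≤ a := min_le_left _ _
    have hb' : μ ≤ b := min_le_right _ _
    have e1 : μ * P ≤ a * P^2 := by
      calc μ * P ≤ a * P := by gcongr
        _ ≤ a * P^2 := by gcongr; nlinarith
    have e2 : μ * (P*q) ≤ b * P * q := by
      rw [mul_assoc]; gcongr
    have e3 : 0 ≤ c * q^2 := by positivity
    nlinarith
  have h0 : 0 < μ * (P * (q+1)) := by positivity
  rw [Real.norm_of_nonneg (h0.le.trans h1)]
  have h2 : 1 ≤ P * (q+1) := by nlinarith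
  calc 1 / Qform a b c P q ^ k ≤ 1 / (μ * (P*(q+1)))^k := by gcongr
    _ = 1 / μ^k * (1 / (P*(q+1))^k) := by rw [mul_pow]; field_simp
    _ ≤ 1 / μ^k * (1 / (P*(q+1))^2) := by gcongr
    _ = _ := by rw [mul_pow]; field_simp

/-- The higher Kronecker "limit" formula for Zagier's zeta function at integer arguments
`k ≥ 2`: the double series `∑_{p≥1,q≥0} e^{2πi(pα+qβ)}/Q(p,q)^k` converges absolutely,
`x ↦ 𝓕_{2k}(x; α, β)` is smooth on `(0,∞)`, and the sum equals
`-∑_{i=0}^{k-1} C(2k-2-i, k-1) (𝓕_{2k}^{(i)}(w) - (-1)^i 𝓕_{2k}^{(i)}(w'))/(i! (w'-w)^{k-1-i})`. -/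
theorem higher_kronecker_limit_formula (a b c : ℝ) (ha : 0 < a) (hb : 0 < b) (hc : 0 < c)
    (hdisc : b ^ 2 - 4 * a * c = 1) (k : ℕ) (hk : 2 ≤ k) (α β : ℝ)
    (hβ : ∀ n : ℤ, β ≠ n)
    (w w' : ℝ) (hw : w = (b + 1) / (2 * c)) (hw' : w' = (b - 1) / (2 * c)) :
    Summable (fun pq : ℕ × ℕ =>
      ‖e2pi ((pq.1 + 1) * α + pq.2 * β) / (Qform a b c (pq.1 + 1) pq.2 : ℂ) ^ k‖) ∧
    ContDiffOn ℝ (⊤ : ℕ∞) (fun x : ℝ => HHZN (2 * k) (x : ℂ) α β) (Set.Ioi 0) ∧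
    ∑' pq : ℕ × ℕ,
        e2pi ((pq.1 + 1) * α + pq.2 * β) / (Qform a b c (pq.1 + 1) pq.2 : ℂ) ^ k
      = -∑ i ∈ Finset.range k,
          ((2 * k - 2 - i).choose (k - 1) : ℂ) *
            (iteratedDeriv i (fun x : ℝ => HHZN (2 * k) (x : ℂ) α β) w -
              (-1) ^ i * iteratedDeriv i (fun x : ℝ => HHZN (2 * k) (x : ℂ) α β) w') /
            ((Nat.factorial i : ℂ) * ((w' - w : ℝ) : ℂ) ^ (k - 1 - i)) := by
  subst hw hw'
  have hb1 : 1 < b := by nlinarith [mul_pos ha hc]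
  have hS := summ_main a b c ha hb hc k hk α β
  have hw0 : 0 < (b + 1) / (2 * c) := by positivity
  have hw0' : 0 < (b - 1) / (2 * c) := div_pos (by linarith) (by positivity)
  have hδ : (b - 1) / (2 * c) - (b + 1) / (2 * c) = -1 / c := by field_simp; ring
  have hQ : ∀ X Y : ℝ, Qform a b c X Y = -((X * ((b + 1) / (2 * c)) + Y) * (X * ((b - 1) / (2 * c)) + Y)) / (-1 / c) := by
    intro X Y
    unfold Qform
    have : a = (b^2-1)/(4*c) := by field_simp; linarith
    rw [this]; field_simp; ring
  rw [← hδ] at hQ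
  have hδ0 : (b - 1) / (2 * c) - (b + 1) / (2 * c) ≠ 0 := by
    rw [hδ]; exact div_ne_zero (by norm_num) hc.ne'
  generalize (b + 1) / (2 * c) = w at *
  generalize (b - 1) / (2 * c) = w' at *
  have hd : ∀ i x, 0 < x → HasDerivAt (fun x => ∑' p, Ft (2*k-1) α β i p x) (∑' p, Ft (2*k-1) α β (i+1) p x) x :=
    fun i x hx => Ft_deriv (2*k-1) (by omega) α β hβ i x hx
  have hF0 : ∀ x : ℝ, 0 < x → (fun x : ℝ => HHZN (2 * k) (x : ℂ) α β) x = ∑' p, Ft (2*k-1) α β 0 p x :=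
    fun x hx => HHZN_eq k hk α β hβ x hx
  refine ⟨hS, ?_, ?_⟩
  · rw [contDiffOn_infty]
    intro n
    exact (smooth_aux (fun i x => ∑' p, Ft (2*k-1) α β i p x) hd n 0).congr fun x hx => hF0 x hx
  have hit := iter_aux (fun x : ℝ => HHZN (2 * k) (x : ℂ) α β) (fun i x => ∑' p, Ft (2*k-1) α β i p x) hF0 hd
  have hrhs : HasSum (fun p => -∑ i ∈ Finset.range k,
          ((2 * k - 2 - i).choose (k - 1) : ℂ) *
            (Ft (2*k-1) α β i p w - (-1) ^ i * Ft (2*k-1) α β i p w') /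
            ((Nat.factorial i : ℂ) * ((w' - w : ℝ) : ℂ) ^ (k - 1 - i)))
      (-∑ i ∈ Finset.range k,
          ((2 * k - 2 - i).choose (k - 1) : ℂ) *
            (iteratedDeriv i (fun x : ℝ => HHZN (2 * k) (x : ℂ) α β) w -
              (-1) ^ i * iteratedDeriv i (fun x : ℝ => HHZN (2 * k) (x : ℂ) α β) w') /
            ((Nat.factorial i : ℂ) * ((w' - w : ℝ) : ℂ) ^ (k - 1 - i))) := by
    apply HasSum.neg
    apply hasSum_sum
    intro i _
    rw [hit i w hw0, hit i w' hw0']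
    exact (((Ft_summable (2*k-1) (by omega) α β hβ i w hw0).hasSum.sub
      ((Ft_summable (2*k-1) (by omega) α β hβ i w' hw0').hasSum.mul_left _)).mul_left _).div_const _
  rw [← hrhs.tsum_eq, hS.of_norm.tsum_prod]
  congr 1
  ext p
  have hSq := hS.of_norm.prod_factor p
  refine tendsto_nhds_unique hSq.hasSum.tendsto_sum_nat ?_
  have hP : (0:ℝ) < ((p+1:ℕ):ℝ) := by positivity
  have hl1 := fun i => Hf_partial β hβ i (((p+1:ℕ):ℝ) * w) (by positivity)
  have hl2 := fun i => Hf_partial β hβ i (((p+1:ℕ):ℝ) * w') (by positivity)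
  have key : Tendsto (fun N : ℕ => -∑ i ∈ Finset.range k,
          ((2 * k - 2 - i).choose (k - 1) : ℂ) *
            (e2pi α ^ (p+1) * ((p+1 : ℕ) : ℂ) ^ i / ((p+1 : ℕ) : ℂ) ^ (2*k-1) * (∑ q ∈ Finset.range N, e2pi β ^ q *
      ((-1) ^ i * (Nat.factorial i : ℂ) / ((((p+1:ℕ):ℝ) * w + q : ℝ) : ℂ) ^ (i+1)))
             - (-1) ^ i * (e2pi α ^ (p+1) * ((p+1 : ℕ) : ℂ) ^ i / ((p+1 : ℕ) : ℂ) ^ (2*k-1) * (∑ q ∈ Finset.range N, e2pi β ^ q *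
      ((-1) ^ i * (Nat.factorial i : ℂ) / ((((p+1:ℕ):ℝ) * w' + q : ℝ) : ℂ) ^ (i+1))))) /
            ((Nat.factorial i : ℂ) * ((w' - w : ℝ) : ℂ) ^ (k - 1 - i))) atTop
      (𝓝 (-∑ i ∈ Finset.range k,
          ((2 * k - 2 - i).choose (k - 1) : ℂ) *
            (Ft (2*k-1) α β i p w - (-1) ^ i * Ft (2*k-1) α β i p w') /
            ((Nat.factorial i : ℂ) * ((w' - w : ℝ) : ℂ) ^ (k - 1 - i)))) := by
    apply Tendsto.neg
    apply tendsto_finsetSum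
    intro i _
    exact ((((hl1 i).const_mul _).sub (((hl2 i).const_mul _).const_mul _)).const_mul _).div_const _
  refine key.congr fun N => ?_
  have hsw : ∀ i : ℕ, ∀ C A S D : ℂ, ∀ f g : ℕ → ℂ,
      C * (A * (∑ q ∈ Finset.range N, f q) - S * (A * ∑ q ∈ Finset.range N, g q)) / D =
      ∑ q ∈ Finset.range N, C * (A * f q - S * (A * g q)) / D := by
    intro i C A S D f g
    simp only [Finset.mul_sum, ← Finset.sum_sub_distrib, Finset.sum_div]
  rw [Finset.sum_congr rfl fun i _ => hsw i _ _ _ _ _ _, Finset.sum_comm, ← Finset.sum_neg_distrib]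
  refine Finset.sum_congr rfl fun q _ => ?_
  obtain ⟨K, rfl⟩ : ∃ K, k = K + 1 := ⟨k-1, by omega⟩
  have hu : ((((p+1:ℕ):ℝ) * w + q : ℝ) : ℂ) ≠ 0 := by
    have : 0 < ((p+1:ℕ):ℝ) * w + q := by positivity
    exact_mod_cast this.ne'
  have hv : ((((p+1:ℕ):ℝ) * w' + q : ℝ) : ℂ) ≠ 0 := by
    have : 0 < ((p+1:ℕ):ℝ) * w' + q := by positivity
    exact_mod_cast this.ne'
  have hpt := pf_pt K ((p+1:ℕ):ℂ) _ _ ((w'-w:ℝ):ℂ) (by exact_mod_cast Nat.succ_ne_zero p) hu hv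
    (by exact_mod_cast hδ0) (by push_cast; ring)
  have hQ' : (Qform a b c ((p:ℝ)+1) (q:ℝ) : ℂ) = -(((((p+1:ℕ):ℝ) * w + q : ℝ) : ℂ) * ((((p+1:ℕ):ℝ) * w' + q : ℝ) : ℂ)) / ((w'-w:ℝ):ℂ) := by
    rw [hQ]; push_cast; ring
  have he : e2pi (((p:ℝ)+1) * α + q * β) = e2pi α ^ (p+1) * e2pi β ^ q := by
    rw [e2pi_add, e2pi_nat_mul, ← e2pi_nat_mul (p+1)]; push_cast; rfl
  simp only
  rw [he, hQ', div_eq_mul_one_div, hpt, mul_neg, Finset.mul_sum]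
  congr 1
  refine Finset.sum_congr rfl fun i _ => ?_
  ring

end
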